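/- Let Q_1 and Q_2 be convex polygons in the plane such that neither can be translated into a proper subset of the other. Label the edges and vertices of both polygons by the rules: if a vertex of one polygon corresponds (via outward normals) only to a vertex of the other, both get 0; if for some outward normal at a vertex of one polygon the parallel face of the other is an edge, the vertex gets -1 and the edge +1; if an edge of one polygon is parallel to a vertex of the other, the edge gets +1 and the vertex -1; if parallel edges have different lengths, the longer gets +1 and the shorter -1, and if equal lengths, both get 0. Let i(Q) be the number of sign changes among nonzero labels in one circuit around Q. Then either Q_1 and Q_2 are translates of each other (and i = 0), or i(Q_1) ≥ 4 and i(Q_2) ≥ 4. -/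

import Mathlib

open MeasureTheory

noncomputable section

/-- A convex polygon in the plane: the convex hull of a finite set of points,
with nonempty interior. -/
def IsConvexPolygon (P : Set (EuclideanSpace ℝ (Fin 2))) : Prop :=
  (∃ S : Finset (EuclideanSpace ℝ (Fin 2)), P = convexHull ℝ (S : Set (EuclideanSpace ℝ (Fin 2)))) ∧
  (interior P).Nonempty

/-- The face of `P` with outward normal vector `n`: the set of maximizers of `⟪·, n⟫` on `P`. -/
def face (P : Set (EuclideanSpace ℝ (Fin 2))) (n : EuclideanSpace ℝ (Fin 2)) :
    Set (EuclideanSpace ℝ (Fin 2)) :=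
  {x | x ∈ P ∧ ∀ y ∈ P, inner (𝕜 := ℝ) y n ≤ inner (𝕜 := ℝ) x n}

/-- The dimension of a face: the dimension of its affine hull. -/
def faceDim (F : Set (EuclideanSpace ℝ (Fin 2))) : ℕ :=
  Module.finrank ℝ (affineSpan ℝ F).direction

/-- `F` is a side (1-dimensional face) of the convex polygon `P`. -/
def IsSide (P F : Set (EuclideanSpace ℝ (Fin 2))) : Prop :=
  ∃ n : EuclideanSpace ℝ (Fin 2), ‖n‖ = 1 ∧ F = face P n ∧ faceDim F = 1

/-- Two segments are parallel: the lines containing them have the same direction. -/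
def SegParallel (F G : Set (EuclideanSpace ℝ (Fin 2))) : Prop :=
  (affineSpan ℝ F).direction = (affineSpan ℝ G).direction

/-- The perimeter of a convex body: the 1-dimensional Hausdorff measure of its boundary. -/
def perimeter (P : Set (EuclideanSpace ℝ (Fin 2))) : ℝ :=
  (μH[(1 : ℝ)] (frontier P)).toReal

/-- `A` can be put inside `B` by a translation: some translate of `A` is a subset of `B`
not coinciding with `B`. -/
def CanPutInside (A B : Set (EuclideanSpace ℝ (Fin 2))) : Prop :=
  ∃ v : EuclideanSpace ℝ (Fin 2), (fun x => v + x) '' A ⊂ B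

/-- `Q` is a translate of `P`. -/
def IsTranslate (P Q : Set (EuclideanSpace ℝ (Fin 2))) : Prop :=
  ∃ v : EuclideanSpace ℝ (Fin 2), Q = (fun x => v + x) '' P

/-- The unit outward normal direction at angle `θ`. -/
def nvec (θ : ℝ) : EuclideanSpace ℝ (Fin 2) := (WithLp.equiv 2 (Fin 2 → ℝ)).symm ![Real.cos θ, Real.sin θ]

open Filter Topology

/-- The length of the face of `Q` with outward normal at angle `θ`. -/
def faceLength (Q : Set (EuclideanSpace ℝ (Fin 2))) (θ : ℝ) : ℝ :=
  (μH[(1 : ℝ)] (face Q (nvec θ))).toReal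

lemma inner_nvec (x : EuclideanSpace ℝ (Fin 2)) (θ : ℝ) :
    inner ℝ x (nvec θ) = x 0 * Real.cos θ + x 1 * Real.sin θ := by
  simp [nvec, PiLp.inner_apply, Fin.sum_univ_two]
  ring

lemma inner_nvec_eq_rotate (x : EuclideanSpace ℝ (Fin 2)) (θ φ : ℝ) :
    inner ℝ x (nvec φ) = Real.cos (φ - θ) * inner ℝ x (nvec θ)
      + Real.sin (φ - θ) * inner ℝ x (nvec (θ + Real.pi / 2)) := by
  simp only [inner_nvec, Real.cos_add_pi_div_two, Real.sin_add_pi_div_two, Real.cos_sub,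
    Real.sin_sub]
  linear_combination (-(x 0 * Real.cos φ) - x 1 * Real.sin φ) * Real.sin_sq_add_cos_sq θ

lemma inner_nvec_add_pi_div_two (θ φ : ℝ) :
    inner ℝ (nvec (θ + Real.pi / 2)) (nvec φ) = Real.sin (φ - θ) := by
  rw [inner_nvec]
  simp [nvec, Real.cos_add_pi_div_two, Real.sin_add_pi_div_two, Real.sin_sub]
  ring

lemma nvec_add_two_pi (θ : ℝ) : nvec (θ + 2 * Real.pi) = nvec θ := by
  simp [nvec]

lemma eq_of_inner_nvec_eq {x y : EuclideanSpace ℝ (Fin 2)} {θ : ℝ}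
    (h : inner ℝ x (nvec θ) = inner ℝ y (nvec θ))
    (h' : inner ℝ x (nvec (θ + Real.pi / 2)) = inner ℝ y (nvec (θ + Real.pi / 2))) : x = y := by
  have key (φ : ℝ) : inner ℝ x (nvec φ) = inner ℝ y (nvec φ) := by
    rw [inner_nvec_eq_rotate x θ φ, inner_nvec_eq_rotate y θ φ, h, h']
  have h0 := key 0
  have h1 := key (Real.pi / 2)
  simp only [inner_nvec, Real.cos_zero, Real.sin_zero, Real.cos_pi_div_two,
    Real.sin_pi_div_two, mul_one, mul_zero, add_zero, zero_add] at h0 h1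
  ext i
  fin_cases i
  · exact h0
  · exact h1

/-- Every vector of the plane is a nonnegative multiple of a unit normal. -/
lemma exists_eq_smul_nvec (u : EuclideanSpace ℝ (Fin 2)) :
    ∃ r θ : ℝ, 0 ≤ r ∧ u = r • nvec θ := by
  let z : ℂ := ⟨u 0, u 1⟩
  refine ⟨‖z‖, z.arg, norm_nonneg z, ?_⟩
  ext i
  fin_cases i
  · simp [nvec, z, Complex.norm_mul_cos_arg]
  · simp [nvec, z, Complex.norm_mul_sin_arg]

/-- A polygon contains every point satisfying its support inequalities. -/
lemma mem_of_forall_exists_inner_le {Q : Set (EuclideanSpace ℝ (Fin 2))}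
    (hQ : IsConvexPolygon Q) (a : ℝ) {y : EuclideanSpace ℝ (Fin 2)}
    (h : ∀ θ, a ≤ θ → θ ≤ a + 2 * Real.pi →
      ∃ x ∈ Q, inner ℝ y (nvec θ) ≤ inner ℝ x (nvec θ)) : y ∈ Q := by
  obtain ⟨⟨S, rfl⟩, -⟩ := hQ
  by_contra hy
  obtain ⟨f, c, hfc, hcy⟩ := geometric_hahn_banach_closed_point (convex_convexHull ℝ _)
    (S.finite_toSet.isClosed_convexHull ℝ) hy
  obtain ⟨r, θ, hr, hu⟩ := exists_eq_smul_nvec ((InnerProductSpace.toDual ℝ _).symm f)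
  have hf (x : EuclideanSpace ℝ (Fin 2)) : f x = r * inner ℝ x (nvec θ) := by
    rw [← InnerProductSpace.toDual_symm_apply (𝕜 := ℝ), hu, real_inner_smul_left,
      real_inner_comm]
  have hper : Function.Periodic nvec (2 * Real.pi) := nvec_add_two_pi
  obtain ⟨θ', hθ', he⟩ := hper.exists_mem_Ico Real.two_pi_pos θ a
  rw [he] at hf
  obtain ⟨x, hx, hle⟩ := h θ' hθ'.1 hθ'.2.le
  have := hfc x hx
  rw [hf] at this hcy
  linarith [mul_le_mul_of_nonneg_left hle hr]

/-- The only maximizer of an inner product over a finite set is its only maximizer over the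
convex hull. -/
lemma face_convexHull_eq_singleton {S : Finset (EuclideanSpace ℝ (Fin 2))}
    {p n : EuclideanSpace ℝ (Fin 2)} (hp : p ∈ S)
    (h : ∀ q ∈ S, q ≠ p → inner ℝ q n < inner ℝ p n) :
    face (convexHull ℝ (S : Set (EuclideanSpace ℝ (Fin 2)))) n = {p} := by
  have hconv : Convex ℝ {x | x = p ∨ inner ℝ x n < inner ℝ p n} := by
    refine convex_iff_pairwise_pos.2 fun x hx y hy hxy a b ha hb hab => Or.inr ?_
    have hp' : inner ℝ p n = a * inner ℝ p n + b * inner ℝ p n := by rw [← add_mul, hab, one_mul]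
    rw [inner_add_left, real_inner_smul_left, real_inner_smul_left, hp']
    rcases hx with rfl | hx
    · have hy := hy.resolve_left hxy.symm
      gcongr
    · rcases hy with rfl | hy <;> gcongr
  have hsub : ∀ x ∈ convexHull ℝ (S : Set (EuclideanSpace ℝ (Fin 2))),
      x = p ∨ inner ℝ x n < inner ℝ p n :=
    convexHull_min (fun q hq => or_iff_not_imp_left.2 (h q hq)) hconv
  have hpS := subset_convexHull ℝ (S : Set (EuclideanSpace ℝ (Fin 2))) hp
  ext x
  constructor
  · rintro ⟨hx, hmax⟩
    exact (hsub x hx).resolve_right (hmax p hpS).not_gt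
  · rintro rfl
    refine ⟨hpS, fun y hy => ?_⟩
    rcases hsub y hy with rfl | hlt
    exacts [le_rfl, hlt.le]

lemma tendsto_const_mul_nhdsGT_zero (σ : ℝ) : Tendsto (fun t : ℝ => σ * t) (𝓝[>] 0) (𝓝 0) := by
  have : Tendsto (fun t : ℝ => σ * t) (𝓝 0) (𝓝 (σ * 0)) := tendsto_id.const_mul σ
  rw [mul_zero] at this
  exact this.mono_left nhdsWithin_le_nhds

lemma tendsto_inner_nvec (x : EuclideanSpace ℝ (Fin 2)) (θ σ : ℝ) :
    Tendsto (fun t : ℝ => inner ℝ x (nvec (θ + σ * t))) (𝓝[>] 0) (𝓝 (inner ℝ x (nvec θ))) := by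
  have h : Tendsto (fun t : ℝ => θ + σ * t) (𝓝[>] 0) (𝓝 θ) := by
    simpa using (tendsto_const_mul_nhdsGT_zero σ).const_add θ
  simp only [inner_nvec]
  exact (((Real.continuous_cos.tendsto θ).comp h).const_mul _).add
    (((Real.continuous_sin.tendsto θ).comp h).const_mul _)

lemma eventually_mul_sin_mul_pos {σ : ℝ} (hσ : σ ≠ 0) :
    ∀ᶠ t in 𝓝[>] (0 : ℝ), 0 < σ * Real.sin (σ * t) := by
  have hb := (tendsto_const_mul_nhdsGT_zero σ).eventually
    (Ioo_mem_nhds (neg_lt_zero.2 Real.pi_pos) Real.pi_pos)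
  filter_upwards [hb, self_mem_nhdsWithin] with t ht ht0
  have ht0 : 0 < t := ht0
  rcases hσ.lt_or_gt with h | h
  · exact mul_pos_of_neg_of_neg h
      (Real.sin_neg_of_neg_of_neg_pi_lt (mul_neg_of_neg_of_pos h ht0) ht.1)
  · exact mul_pos h (Real.sin_pos_of_pos_of_lt_pi (mul_pos h ht0) ht.2)

/-- At every angle, in either direction `σ`, one point of a finite set is the only extreme
one for all sufficiently close normals. -/
lemma exists_eventually_inner_lt {S : Finset (EuclideanSpace ℝ (Fin 2))} (hS : S.Nonempty)
    (θ σ : ℝ) (hσ : σ ≠ 0) :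
    ∃ p ∈ S, ∀ᶠ t in 𝓝[>] (0 : ℝ), ∀ q ∈ S, q ≠ p →
      inner ℝ q (nvec (θ + σ * t)) < inner ℝ p (nvec (θ + σ * t)) := by
  obtain ⟨p, hp, hmax⟩ := S.exists_max_image (fun x : EuclideanSpace ℝ (Fin 2) =>
    toLex (inner ℝ x (nvec θ), σ * inner ℝ x (nvec (θ + Real.pi / 2)))) hS
  refine ⟨p, hp, (eventually_all_finset S).2 fun q hq => ?_⟩
  by_cases hqp : q = p
  · simp [hqp]
  rcases (Prod.Lex.toLex_le_toLex.1 (hmax q hq)) with hlt | ⟨heq, hle⟩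
  · have h1 := (tendsto_inner_nvec p θ σ).sub (tendsto_inner_nvec q θ σ)
    filter_upwards [h1.eventually_const_lt (sub_pos.2 hlt)] with t ht _
    linarith
  · have hlt : σ * inner ℝ q (nvec (θ + Real.pi / 2)) < σ * inner ℝ p (nvec (θ + Real.pi / 2)) :=
      lt_of_le_of_ne hle fun h => hqp (eq_of_inner_nvec_eq heq (mul_left_cancel₀ hσ h))
    filter_upwards [eventually_mul_sin_mul_pos hσ] with t ht _
    have heq' : inner ℝ q (nvec θ) = inner ℝ p (nvec θ) := heq
    rw [inner_nvec_eq_rotate q θ, inner_nvec_eq_rotate p θ, heq', add_sub_cancel_left,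
      add_lt_add_iff_left]
    have : 0 < σ * σ := mul_self_pos.2 hσ
    nlinarith [mul_lt_mul_of_pos_right hlt ht]

/-- At every angle, in either direction `σ`, the faces of a polygon with sufficiently close
normals are one and the same point, the last one in this direction of the face at the angle. -/
lemma IsConvexPolygon.exists_eventually_face_eq {Q : Set (EuclideanSpace ℝ (Fin 2))}
    (hQ : IsConvexPolygon Q) (θ σ : ℝ) (hσ : σ ≠ 0) :
    ∃ p ∈ face Q (nvec θ), (∀ᶠ t in 𝓝[>] (0 : ℝ), face Q (nvec (θ + σ * t)) = {p}) ∧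
      ∀ y ∈ face Q (nvec θ), σ * inner ℝ y (nvec (θ + Real.pi / 2)) ≤
        σ * inner ℝ p (nvec (θ + Real.pi / 2)) := by
  obtain ⟨⟨S, rfl⟩, hne⟩ := hQ
  have hS : S.Nonempty := by
    simpa using (convexHull_nonempty_iff.1 (hne.mono interior_subset))
  obtain ⟨p, hp, hev⟩ := exists_eventually_inner_lt hS θ σ hσ
  have hface := hev.mono fun t ht => face_convexHull_eq_singleton hp ht
  set Q := convexHull ℝ (S : Set (EuclideanSpace ℝ (Fin 2)))
  have hpQ : p ∈ Q := subset_convexHull ℝ _ hp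
  have hle : ∀ y ∈ Q, ∀ᶠ t in 𝓝[>] (0 : ℝ),
      inner ℝ y (nvec (θ + σ * t)) ≤ inner ℝ p (nvec (θ + σ * t)) := fun y hy => by
    filter_upwards [hface] with t ht
    have hpt : p ∈ face Q (nvec (θ + σ * t)) := ht ▸ rfl
    exact hpt.2 y hy
  have hpf : p ∈ face Q (nvec θ) := ⟨hpQ, fun y hy =>
    le_of_tendsto_of_tendsto (tendsto_inner_nvec y θ σ) (tendsto_inner_nvec p θ σ) (hle y hy)⟩
  refine ⟨p, hpf, hface, fun y hy => ?_⟩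
  obtain ⟨t, ht, hs⟩ := ((hle y hy.1).and (eventually_mul_sin_mul_pos hσ)).exists
  rw [inner_nvec_eq_rotate y θ, inner_nvec_eq_rotate p θ, add_sub_cancel_left,
    le_antisymm (hpf.2 y hy.1) (hy.2 p hpQ), add_le_add_iff_left] at ht
  have : 0 < σ * σ := mul_self_pos.2 hσ
  refine le_of_mul_le_mul_left ?_ hs
  nlinarith [mul_le_mul_of_nonneg_left ht this.le]

lemma convex_face {Q : Set (EuclideanSpace ℝ (Fin 2))} (hQ : Convex ℝ Q)
    (n : EuclideanSpace ℝ (Fin 2)) : Convex ℝ (face Q n) := by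
  intro x hx y hy a b ha hb hab
  refine ⟨hQ hx.1 hy.1 ha hb hab, fun z hz => ?_⟩
  rw [inner_add_left, real_inner_smul_left, real_inner_smul_left]
  calc inner ℝ z n = a * inner ℝ z n + b * inner ℝ z n := by rw [← add_mul, hab, one_mul]
    _ ≤ a * inner ℝ x n + b * inner ℝ y n :=
      add_le_add (mul_le_mul_of_nonneg_left (hx.2 z hz) ha)
        (mul_le_mul_of_nonneg_left (hy.2 z hz) hb)

lemma faceLength_eq_zero {Q : Set (EuclideanSpace ℝ (Fin 2))} {θ : ℝ}
    {p : EuclideanSpace ℝ (Fin 2)} (h : face Q (nvec θ) = {p}) : faceLength Q θ = 0 := by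
  rw [faceLength, h, ← segment_same ℝ p, hausdorffMeasure_segment]
  simp

/-- The extreme points of a face differ by its length along the face. -/
lemma sub_eq_faceLength_smul {Q : Set (EuclideanSpace ℝ (Fin 2))} (hQ : Convex ℝ Q) {θ : ℝ}
    {p q : EuclideanSpace ℝ (Fin 2)} (hp : p ∈ face Q (nvec θ)) (hq : q ∈ face Q (nvec θ))
    (hple : ∀ y ∈ face Q (nvec θ),
      inner ℝ y (nvec (θ + Real.pi / 2)) ≤ inner ℝ p (nvec (θ + Real.pi / 2)))
    (hqle : ∀ y ∈ face Q (nvec θ),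
      inner ℝ q (nvec (θ + Real.pi / 2)) ≤ inner ℝ y (nvec (θ + Real.pi / 2))) :
    p - q = faceLength Q θ • nvec (θ + Real.pi / 2) := by
  have hsub : ∀ y ∈ face Q (nvec θ), y - q = (inner ℝ y (nvec (θ + Real.pi / 2)) -
      inner ℝ q (nvec (θ + Real.pi / 2))) • nvec (θ + Real.pi / 2) := by
    intro y hy
    refine eq_of_inner_nvec_eq (θ := θ) ?_ ?_
    · rw [inner_sub_left, real_inner_smul_left, inner_nvec_add_pi_div_two,
        le_antisymm (hq.2 y hy.1) (hy.2 q hq.1)]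
      simp
    · rw [inner_sub_left, real_inner_smul_left, inner_nvec_add_pi_div_two]
      simp
  have hseg : face Q (nvec θ) = segment ℝ q p := by
    refine Set.Subset.antisymm (fun y hy => ?_) ((convex_face hQ _).segment_subset hq hp)
    rw [segment_eq_image']
    have h1 := hple y hy
    have h2 := hqle y hy
    rcases (h2.trans h1).eq_or_lt with h | h
    · refine ⟨0, by simp, ?_⟩
      have := hsub y hy
      rw [le_antisymm (h ▸ h1) h2, sub_self, zero_smul, sub_eq_zero] at this
      simp [this]
    · refine ⟨_, ⟨div_nonneg (sub_nonneg.2 h2) (sub_nonneg.2 h.le),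
        (div_le_one (sub_pos.2 h)).2 (sub_le_sub_right h1 _)⟩, ?_⟩
      simp only
      rw [hsub p hp, smul_smul, div_mul_cancel₀ _ (sub_pos.2 h).ne', ← hsub y hy]
      abel
  have hnorm : ‖nvec (θ + Real.pi / 2)‖ = 1 := by
    rw [norm_eq_sqrt_real_inner, inner_nvec_add_pi_div_two]
    simp
  rw [faceLength, hseg, hausdorffMeasure_segment, edist_dist, ENNReal.toReal_ofReal dist_nonneg,
    dist_comm, dist_eq_norm, hsub p hp, norm_smul, hnorm, mul_one, Real.norm_of_nonneg
    (sub_nonneg.2 (hqle p hp))]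

/-- A point `A θ` moving around a polygon, or a difference of such points: it is locally
constant apart from jumps of length `c θ` along the edges with outward normal at angle `θ`. -/
structure IsEdgePath (A : ℝ → EuclideanSpace ℝ (Fin 2)) (c : ℝ → ℝ) : Prop where
  right : ∀ θ, ∀ᶠ x in 𝓝[>] θ, A x = A θ ∧ c x = 0
  left : ∀ θ, ∀ᶠ x in 𝓝[<] θ, A x = A θ - c θ • nvec (θ + Real.pi / 2) ∧ c x = 0

lemma IsEdgePath.sub {A B : ℝ → EuclideanSpace ℝ (Fin 2)} {c d : ℝ → ℝ}
    (hA : IsEdgePath A c) (hB : IsEdgePath B d) : IsEdgePath (A - B) (c - d) where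
  right θ := by
    filter_upwards [hA.right θ, hB.right θ] with x h h'
    simp [h.1, h.2, h'.1, h'.2]
  left θ := by
    filter_upwards [hA.left θ, hB.left θ] with x h h'
    refine ⟨?_, by simp [h.2, h'.2]⟩
    simp only [Pi.sub_apply, h.1, h'.1, sub_smul]
    abel

lemma face_translate (Q : Set (EuclideanSpace ℝ (Fin 2))) (v n : EuclideanSpace ℝ (Fin 2)) :
    face ((fun x => v + x) '' Q) n = (fun x => v + x) '' face Q n := by
  ext x
  constructor
  · rintro ⟨⟨y, hy, rfl⟩, h⟩
    refine ⟨y, ⟨hy, fun z hz => ?_⟩, rfl⟩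
    simpa [inner_add_left] using h _ ⟨z, hz, rfl⟩
  · rintro ⟨y, ⟨hy, h⟩, rfl⟩
    refine ⟨⟨y, hy, rfl⟩, ?_⟩
    rintro _ ⟨z, hz, rfl⟩
    simpa [inner_add_left] using h z hz

lemma faceLength_translate (Q : Set (EuclideanSpace ℝ (Fin 2))) (v : EuclideanSpace ℝ (Fin 2))
    (θ : ℝ) : faceLength ((fun x => v + x) '' Q) θ = faceLength Q θ := by
  rw [faceLength, faceLength, face_translate]
  exact congrArg ENNReal.toReal ((IsometryEquiv.addLeft v).hausdorffMeasure_image 1 _)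

/-- A locally increasing real function is increasing. -/
lemma le_of_eventually_le {w : ℝ → ℝ} {a b : ℝ} (hab : a ≤ b)
    (hr : ∀ x, a ≤ x → x < b → ∀ᶠ y in 𝓝[>] x, w x ≤ w y)
    (hl : ∀ x, a < x → x ≤ b → ∀ᶠ y in 𝓝[<] x, w y ≤ w x) : w a ≤ w b := by
  set S := {x ∈ Set.Icc a b | ∀ y ∈ Set.Icc a x, w a ≤ w y}
  have haS : a ∈ S := ⟨⟨le_rfl, hab⟩, fun y hy => by rw [le_antisymm hy.2 hy.1]⟩
  have hbdd : BddAbove S := ⟨b, fun x hx => hx.1.2⟩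
  have hac : a ≤ sSup S := le_csSup hbdd haS
  have hcb : sSup S ≤ b := csSup_le ⟨a, haS⟩ fun x hx => hx.1.2
  have hlt : ∀ y, a ≤ y → y < sSup S → w a ≤ w y := fun y hay hy => by
    obtain ⟨x, hx, hyx⟩ := exists_lt_of_lt_csSup ⟨a, haS⟩ hy
    exact hx.2 y ⟨hay, hyx.le⟩
  have hc : w a ≤ w (sSup S) := by
    rcases hac.eq_or_lt with h | h
    · rw [← h]
    · obtain ⟨y, hy, hy'⟩ := ((hl _ h hcb).and (Ioo_mem_nhdsLT h)).exists
      exact (hlt y hy'.1.le hy'.2).trans hy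
  rcases hcb.eq_or_lt with h | h
  · rwa [h] at hc
  obtain ⟨d, hd, hsub⟩ := (mem_nhdsGT_iff_exists_Ioo_subset' h).1 (hr _ hac h)
  obtain ⟨e, hce, hed⟩ := exists_between (lt_min hd h)
  have heS : e ∈ S := by
    refine ⟨⟨hac.trans hce.le, (hed.trans_le (min_le_right _ _)).le⟩, fun y hy => ?_⟩
    rcases lt_trichotomy y (sSup S) with hy' | rfl | hy'
    · exact hlt y hy.1 hy'
    · exact hc
    · exact hc.trans (hsub ⟨hy', hy.2.trans_lt (hed.trans_le (min_le_left _ _))⟩)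
  exact absurd (le_csSup hbdd heS) hce.not_ge

lemma IsEdgePath.inner_le {A : ℝ → EuclideanSpace ℝ (Fin 2)} {c : ℝ → ℝ} (hA : IsEdgePath A c)
    {a b φ : ℝ} (hab : a ≤ b) (h : ∀ x, a < x → x ≤ b → 0 ≤ c x * Real.sin (φ - x)) :
    inner ℝ (A a) (nvec φ) ≤ inner ℝ (A b) (nvec φ) := by
  refine le_of_eventually_le (w := fun x => inner ℝ (A x) (nvec φ)) hab (fun x _ _ => ?_)
    fun x hax hxb => ?_
  · filter_upwards [hA.right x] with y hy
    rw [hy.1]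
  · filter_upwards [hA.left x] with y hy
    rw [hy.1, inner_sub_left, real_inner_smul_left, inner_nvec_add_pi_div_two]
    linarith [h x hax hxb]

lemma IsEdgePath.inner_ge {A : ℝ → EuclideanSpace ℝ (Fin 2)} {c : ℝ → ℝ} (hA : IsEdgePath A c)
    {a b φ : ℝ} (hab : a ≤ b) (h : ∀ x, a < x → x ≤ b → c x * Real.sin (φ - x) ≤ 0) :
    inner ℝ (A b) (nvec φ) ≤ inner ℝ (A a) (nvec φ) := by
  have := le_of_eventually_le (w := fun x => -inner ℝ (A x) (nvec φ)) hab (fun x _ _ => ?_)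
    fun x hax hxb => ?_
  · simpa using this
  · filter_upwards [hA.right x] with y hy
    rw [hy.1]
  · filter_upwards [hA.left x] with y hy
    rw [hy.1, inner_sub_left, real_inner_smul_left, inner_nvec_add_pi_div_two]
    linarith [h x hax hxb]

/-- Walking counterclockwise around a convex polygon gives an edge path. -/
lemma IsConvexPolygon.exists_isEdgePath {Q : Set (EuclideanSpace ℝ (Fin 2))}
    (hQ : IsConvexPolygon Q) :
    ∃ A, IsEdgePath A (faceLength Q) ∧ ∀ θ, A θ ∈ face Q (nvec θ) := by
  choose p hp hpface hple using fun θ => hQ.exists_eventually_face_eq θ 1 one_ne_zero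
  choose q hq hqface hqle using fun θ => hQ.exists_eventually_face_eq θ (-1) (by norm_num)
  have hconv : Convex ℝ Q := by
    obtain ⟨⟨S, rfl⟩, -⟩ := hQ
    exact convex_convexHull ℝ _
  refine ⟨p, ⟨fun θ => ?_, fun θ => ?_⟩, hp⟩
  · have ht : Tendsto (fun x => x - θ) (𝓝[>] θ) (𝓝[>] 0) := by
      refine tendsto_nhdsWithin_iff.2 ⟨?_, ?_⟩
      · have : Tendsto (fun x => x - θ) (𝓝 θ) (𝓝 (θ - θ)) := tendsto_id.sub_const θ
        rw [sub_self] at this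
        exact this.mono_left nhdsWithin_le_nhds
      · filter_upwards [self_mem_nhdsWithin] with x hx
        exact sub_pos.2 (by simpa using hx)
    filter_upwards [ht.eventually (hpface θ)] with x hx
    rw [one_mul, add_sub_cancel] at hx
    exact ⟨hx.subset (hp x), faceLength_eq_zero hx⟩
  · have ht : Tendsto (fun x => θ - x) (𝓝[<] θ) (𝓝[>] 0) := by
      refine tendsto_nhdsWithin_iff.2 ⟨?_, ?_⟩
      · have : Tendsto (fun x => θ - x) (𝓝 θ) (𝓝 (θ - θ)) := tendsto_id.const_sub θ
        rw [sub_self] at this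
        exact this.mono_left nhdsWithin_le_nhds
      · filter_upwards [self_mem_nhdsWithin] with x hx
        exact sub_pos.2 (by simpa using hx)
    filter_upwards [ht.eventually (hqface θ)] with x hx
    rw [show θ + -1 * (θ - x) = x by ring] at hx
    refine ⟨?_, faceLength_eq_zero hx⟩
    rw [← sub_eq_faceLength_smul hconv (hp θ) (hq θ)
      (fun y hy => by simpa using hple θ y hy) (fun y hy => by simpa using hqle θ y hy),
      sub_sub_cancel]
    exact hx.subset (hp x)

/-- If the jumps are nonpositive on an arc shorter than `π` and nonnegative on the complementary
arc, then the path lies beyond its position in the middle of the latter arc, as seen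
along all normals. -/
lemma IsEdgePath.inner_mid_le {A : ℝ → EuclideanSpace ℝ (Fin 2)} {c : ℝ → ℝ}
    (hA : IsEdgePath A c)
    (hper : ∀ θ, inner ℝ (A (θ + 2 * Real.pi)) (nvec θ) = inner ℝ (A θ) (nvec θ))
    {a b : ℝ} (hab : a ≤ b) (hba : b - a < Real.pi)
    (hneg : ∀ x, a < x → x < b → c x ≤ 0)
    (hpos : ∀ x, b < x → x < a + 2 * Real.pi → 0 ≤ c x)
    {φ : ℝ} (haφ : a ≤ φ) (hφ : φ ≤ a + 2 * Real.pi) :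
    inner ℝ (A ((a + b) / 2 + Real.pi)) (nvec φ) ≤ inner ℝ (A φ) (nvec φ) := by
  set m := (a + b) / 2 + Real.pi with hm
  have hπ := Real.pi_pos
  have hright : ∀ φ, m ≤ φ → φ ≤ a + 2 * Real.pi →
      inner ℝ (A m) (nvec φ) ≤ inner ℝ (A φ) (nvec φ) := fun φ h1 h2 =>
    hA.inner_le h1 fun x hx hx' => by
      rcases hx'.eq_or_lt with rfl | hlt
      · simp
      exact mul_nonneg (hpos x (by linarith) (by linarith))
        (Real.sin_nonneg_of_nonneg_of_le_pi (by linarith) (by linarith))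
  have hleft : ∀ φ, b ≤ φ → φ ≤ m →
      inner ℝ (A m) (nvec φ) ≤ inner ℝ (A φ) (nvec φ) := fun φ h1 h2 =>
    hA.inner_ge h2 fun x hx hx' =>
      mul_nonpos_of_nonneg_of_nonpos (hpos x (by linarith) (by linarith))
        (Real.sin_nonpos_of_nonpos_of_neg_pi_le (by linarith) (by linarith))
  rcases le_total m φ with h | h
  · exact hright φ h hφ
  rcases le_total b φ with h' | h'
  · exact hleft φ h' h
  have hga : inner ℝ (A m) (nvec a) ≤ inner ℝ (A a) (nvec a) := by
    have := hright (a + 2 * Real.pi) (by linarith) le_rfl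
    rwa [nvec_add_two_pi, hper] at this
  have hgb := hleft b le_rfl (by linarith)
  rcases h'.eq_or_lt with rfl | hφb
  · exact hgb
  have hAa : inner ℝ (A a) (nvec a) ≤ inner ℝ (A φ) (nvec a) :=
    hA.inner_le haφ fun x hx hx' => by
      exact mul_nonneg_of_nonpos_of_nonpos (hneg x hx (hx'.trans_lt hφb))
        (Real.sin_nonpos_of_nonpos_of_neg_pi_le (by linarith) (by linarith))
  have hAb : inner ℝ (A b) (nvec b) ≤ inner ℝ (A φ) (nvec b) :=
    hA.inner_ge h' fun x hx hx' => by
      rcases hx'.eq_or_lt with rfl | hlt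
      · simp
      exact mul_nonpos_of_nonpos_of_nonneg (hneg x (by linarith) hlt)
        (Real.sin_nonneg_of_nonneg_of_le_pi (by linarith) (by linarith))
  have hrot (x : EuclideanSpace ℝ (Fin 2)) : Real.sin (b - a) * inner ℝ x (nvec φ) =
      Real.sin (b - φ) * inner ℝ x (nvec a) + Real.sin (φ - a) * inner ℝ x (nvec b) := by
    simp only [inner_nvec_eq_rotate x a φ, inner_nvec_eq_rotate x a b]
    rw [show b - φ = (b - a) - (φ - a) by ring, Real.sin_sub (b - a)]
    ring
  have hs : 0 < Real.sin (b - a) := Real.sin_pos_of_pos_of_lt_pi (by linarith) hba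
  refine le_of_mul_le_mul_left ?_ hs
  rw [hrot, hrot]
  exact add_le_add
    (mul_le_mul_of_nonneg_left (hga.trans hAa)
      (Real.sin_nonneg_of_nonneg_of_le_pi (by linarith) (by linarith)))
    (mul_le_mul_of_nonneg_left (hgb.trans hAb)
      (Real.sin_nonneg_of_nonneg_of_le_pi (by linarith) (by linarith)))

/-- On the circle, `c` is nonpositive on an arc shorter than `π` and nonnegative on the
complementary arc. -/
def HasShortNonposArc (c : ℝ → ℝ) : Prop :=
  ∃ a b : ℝ, a ≤ b ∧ b - a < Real.pi ∧ (∀ x, a < x → x < b → c x ≤ 0) ∧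
    ∀ x, b < x → x < a + 2 * Real.pi → 0 ≤ c x

/-- The polygon with the longer edges, except on a short arc of normals, contains a translate of
the other one. -/
lemma exists_translate_subset {Q₁ Q₂ : Set (EuclideanSpace ℝ (Fin 2))}
    (h₁ : IsConvexPolygon Q₁) (h₂ : IsConvexPolygon Q₂)
    (h : HasShortNonposArc (faceLength Q₁ - faceLength Q₂)) :
    ∃ v : EuclideanSpace ℝ (Fin 2), (fun x => v + x) '' Q₂ ⊆ Q₁ := by
  obtain ⟨a, b, hab, hba, hneg, hpos⟩ := h
  obtain ⟨A, hA, hAf⟩ := h₁.exists_isEdgePath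
  obtain ⟨B, hB, hBf⟩ := h₂.exists_isEdgePath
  have hper {Q : Set (EuclideanSpace ℝ (Fin 2))} {C : ℝ → EuclideanSpace ℝ (Fin 2)}
      (hC : ∀ θ, C θ ∈ face Q (nvec θ)) (θ : ℝ) :
      inner ℝ (C (θ + 2 * Real.pi)) (nvec θ) = inner ℝ (C θ) (nvec θ) := by
    have h := hC (θ + 2 * Real.pi)
    rw [nvec_add_two_pi] at h
    exact le_antisymm ((hC θ).2 _ h.1) (h.2 _ (hC θ).1)
  refine ⟨(A - B) ((a + b) / 2 + Real.pi), ?_⟩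
  rintro _ ⟨y, hy, rfl⟩
  refine mem_of_forall_exists_inner_le h₁ a fun θ hθ hθ' => ⟨A θ, (hAf θ).1, ?_⟩
  have hle := (hA.sub hB).inner_mid_le
    (fun θ => by simp [inner_sub_left, hper hAf, hper hBf]) hab hba hneg hpos hθ hθ'
  have hy' := (hBf θ).2 y hy
  rw [Pi.sub_apply A B θ, inner_sub_left] at hle
  rw [inner_add_left]
  linarith

/-- `c` takes values of alternating signs, starting with a positive one, at four points of the
circle in cyclic order. -/
def HasFourAlternations (c : ℝ → ℝ) : Prop :=
  ∃ θ₁ θ₂ θ₃ θ₄ : ℝ, θ₁ < θ₂ ∧ θ₂ < θ₃ ∧ θ₃ < θ₄ ∧ θ₄ < θ₁ + 2 * Real.pi ∧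
    0 < c θ₁ ∧ c θ₂ < 0 ∧ 0 < c θ₃ ∧ c θ₄ < 0

/-- A set without accumulation points has a least and a greatest element in every interval
it meets. -/
lemma exists_isLeast_isGreatest_inter_Icc {S : Set ℝ} (hS : ∀ x, ∀ᶠ y in 𝓝[≠] x, y ∉ S)
    {a b : ℝ} (hne : (S ∩ Set.Icc a b).Nonempty) :
    (∃ x, IsLeast (S ∩ Set.Icc a b) x) ∧ ∃ x, IsGreatest (S ∩ Set.Icc a b) x := by
  have hcl : IsClosed S := isClosed_iff_frequently.2 fun x hx => by
    by_contra hxS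
    refine hx ?_
    filter_upwards [eventually_nhdsWithin_iff.1 (hS x)] with y hy hyS
    exact hy (fun h => hxS (h ▸ hyS)) hyS
  have hc := (isCompact_Icc (a := a) (b := b)).inter_left hcl
  exact ⟨hc.exists_isLeast hne, hc.exists_isGreatest hne⟩

/-- A function with finite support on the circle and fewer than four sign changes is, up to its
sign, nonpositive on an arc shorter than `π` and nonnegative on the complementary arc. -/
lemma hasFourAlternations_or_hasShortNonposArc {c : ℝ → ℝ}
    (hper : Function.Periodic c (2 * Real.pi)) (hc : ∀ x, ∀ᶠ y in 𝓝[≠] x, c y = 0) :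
    HasFourAlternations c ∨ HasShortNonposArc c ∨ HasShortNonposArc (-c) := by
  have hπ := Real.pi_pos
  by_cases hN : ∃ n, c n < 0
  swap
  · push Not at hN
    exact Or.inr (Or.inl ⟨0, 0, le_rfl, by simpa, fun x h h' => (h.not_gt h').elim,
      fun x _ _ => hN x⟩)
  by_cases hP : ∃ p, 0 < c p
  swap
  · push Not at hP
    exact Or.inr (Or.inr ⟨0, 0, le_rfl, by simpa, fun x h h' => (h.not_gt h').elim,
      fun x _ _ => neg_nonneg.2 (hP x)⟩)
  obtain ⟨n₀, hn₀⟩ := hN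
  obtain ⟨p, hp⟩ := hP
  obtain ⟨n, hn, hnn⟩ := hper.exists_mem_Ico Real.two_pi_pos n₀ p
  rw [hnn] at hn₀
  have hp' : 0 < c (p + 2 * Real.pi) := by rwa [hper]
  obtain ⟨⟨a, ha⟩, b, hb⟩ := exists_isLeast_isGreatest_inter_Icc (S := {x | c x < 0})
    (fun x => (hc x).mono fun y hy => by simp [hy]) ⟨n, hn₀, hn.1, hn.2.le⟩
  have hca : c a < 0 := ha.1.1
  have hcb : c b < 0 := hb.1.1
  have hpa : p < a := ha.1.2.1.lt_of_ne fun h => (h ▸ hca).not_gt hp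
  have hbp : b < p + 2 * Real.pi := hb.1.2.2.lt_of_ne fun h => (h ▸ hcb).not_gt hp'
  have hab : a ≤ b := ha.2 hb.1
  by_cases hmid : ∃ x, a < x ∧ x < b ∧ 0 < c x
  · obtain ⟨x, hax, hxb, hx⟩ := hmid
    exact Or.inl ⟨p, a, x, b, hpa, hax, hxb, hbp, hp, hca, hx, hcb⟩
  push Not at hmid
  have hout : ∀ x, b < x → x < a + 2 * Real.pi → 0 ≤ c x := by
    intro x hbx hxa
    by_contra! hx
    rcases le_or_gt x (p + 2 * Real.pi) with h | h
    · exact (hb.2 ⟨hx, by linarith, h⟩).not_gt hbx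
    · have hx' : c (x - 2 * Real.pi) < 0 := by rwa [hper.sub_eq]
      have := ha.2 ⟨hx', by linarith, by linarith⟩
      linarith
  refine Or.inr ?_
  by_cases hshort : b - a < Real.pi
  · exact Or.inl ⟨a, b, hab, hshort, hmid, hout⟩
  obtain ⟨⟨d, hd⟩, e, he⟩ := exists_isLeast_isGreatest_inter_Icc (S := {x | 0 < c x})
    (fun x => (hc x).mono fun y hy => by simp [hy])
    (a := b) (b := a + 2 * Real.pi) ⟨p + 2 * Real.pi, hp', hbp.le, by linarith⟩
  have hcd : 0 < c d := hd.1.1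
  have hce : 0 < c e := he.1.1
  have hbd : b < d := hd.1.2.1.lt_of_ne fun h => (h ▸ hcd).not_gt hcb
  have hea : e < a + 2 * Real.pi := he.1.2.2.lt_of_ne fun h => by
    rw [h, hper] at hce
    exact hce.not_gt hca
  refine Or.inr ⟨d, e, hd.2 he.1, by linarith, fun x hx hx' =>
    neg_nonpos.2 (hout x (by linarith) (by linarith)), fun x hx hx' => neg_nonneg.2 ?_⟩
  by_contra! hpos
  have hpos' : 0 < c (x - 2 * Real.pi) := by rwa [hper.sub_eq]
  rcases le_or_gt x (a + 2 * Real.pi) with h | h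
  · exact (he.2 ⟨hpos, by linarith [hd.2 he.1], h⟩).not_gt hx
  rcases le_or_gt x (b + 2 * Real.pi) with h' | h'
  · rcases h'.eq_or_lt with rfl | h'
    · rw [hper] at hpos
      exact hpos.not_gt hcb
    · exact (hmid (x - 2 * Real.pi) (by linarith) (by linarith)).not_gt hpos'
  · have := hd.2 ⟨hpos', by linarith, by linarith [hd.2 he.1]⟩
    linarith

/-- If `Q₂` cannot be put inside `Q₁`, but the edges of `Q₁` are the longer ones except on a short
arc of normals, then the two polygons are translates of each other. -/
lemma eq_translate_of_hasShortNonposArc {Q₁ Q₂ : Set (EuclideanSpace ℝ (Fin 2))}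
    (h₁ : IsConvexPolygon Q₁) (h₂ : IsConvexPolygon Q₂) (hno : ¬ CanPutInside Q₂ Q₁)
    (h : HasShortNonposArc (faceLength Q₁ - faceLength Q₂)) : IsTranslate Q₂ Q₁ := by
  obtain ⟨v, hv⟩ := exists_translate_subset h₁ h₂ h
  by_contra hne
  exact hno ⟨v, hv.ssubset_of_ne fun h => hne ⟨v, h.symm⟩⟩

lemma IsTranslate.symm {P Q : Set (EuclideanSpace ℝ (Fin 2))} (h : IsTranslate P Q) :
    IsTranslate Q P := by
  obtain ⟨v, rfl⟩ := h
  refine ⟨-v, ?_⟩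
  rw [Set.image_image]
  simp

lemma IsTranslate.faceLength_eq {P Q : Set (EuclideanSpace ℝ (Fin 2))} (h : IsTranslate P Q)
    (θ : ℝ) : faceLength Q θ = faceLength P θ := by
  obtain ⟨v, rfl⟩ := h
  exact faceLength_translate P v θ

lemma IsEdgePath.eventually_eq_zero {A : ℝ → EuclideanSpace ℝ (Fin 2)} {c : ℝ → ℝ}
    (hA : IsEdgePath A c) (θ : ℝ) : ∀ᶠ x in 𝓝[≠] θ, c x = 0 := by
  rw [← Set.Iio_union_Ioi, nhdsWithin_union, eventually_sup]
  exact ⟨(hA.left θ).mono fun _ h => h.2, (hA.right θ).mono fun _ h => h.2⟩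

/-- **Alexandrov's lemma on parallel polygons (Lemma 4.4).** Labels are encoded by the sign
function `s θ = sign(length(face Q₁ (nvec θ)) − length(face Q₂ (nvec θ)))` (a vertex counts
as a face of length `0`): this reproduces rules (i)–(iv), the label of the face of `Q₁` in
direction `θ` being `s θ` and the label of the face of `Q₂` being `-s θ`, so that the
indices `i(Q₁)` and `i(Q₂)` both equal the number of sign changes of `s` in one circuit of
the circle.  Conclusion: if neither polygon can be translated into a proper subset of the
other, then either the polygons are translates of each other and all labels vanish
(`i = 0`), or there are at least `4` sign alternations of `s` in one circuit, i.e.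
`i(Q₁) ≥ 4` and `i(Q₂) ≥ 4`. -/
theorem alexandrov_lemma_parallel_polygons
    (Q₁ Q₂ : Set (EuclideanSpace ℝ (Fin 2)))
    (h₁ : IsConvexPolygon Q₁) (h₂ : IsConvexPolygon Q₂)
    (hno₁ : ¬ CanPutInside Q₁ Q₂) (hno₂ : ¬ CanPutInside Q₂ Q₁)
    (s : ℝ → ℤ)
    (hs : ∀ θ : ℝ, (s θ : ℝ) =
      Real.sign ((μH[(1 : ℝ)] (face Q₁ (nvec θ))).toReal
        - (μH[(1 : ℝ)] (face Q₂ (nvec θ))).toReal)) :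
    (IsTranslate Q₁ Q₂ ∧ ∀ θ : ℝ, s θ = 0) ∨
    (∃ θ₁ θ₂ θ₃ θ₄ : ℝ, θ₁ < θ₂ ∧ θ₂ < θ₃ ∧ θ₃ < θ₄ ∧ θ₄ < θ₁ + 2 * Real.pi ∧
      ((0 < s θ₁ ∧ s θ₂ < 0 ∧ 0 < s θ₃ ∧ s θ₄ < 0) ∨
       (s θ₁ < 0 ∧ 0 < s θ₂ ∧ s θ₃ < 0 ∧ 0 < s θ₄))) := by
  have hs' : ∀ θ, (s θ : ℝ) = Real.sign ((faceLength Q₁ - faceLength Q₂) θ) := hs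
  have hpos : ∀ θ, 0 < (faceLength Q₁ - faceLength Q₂) θ → 0 < s θ := fun θ h => by
    have := hs' θ
    rw [Real.sign_of_pos h] at this
    exact_mod_cast this ▸ zero_lt_one
  have hneg : ∀ θ, (faceLength Q₁ - faceLength Q₂) θ < 0 → s θ < 0 := fun θ h => by
    have := hs' θ
    rw [Real.sign_of_neg h] at this
    have h0 : (s θ : ℝ) < 0 := by rw [this]; norm_num
    exact_mod_cast h0
  have hzero : IsTranslate Q₁ Q₂ → IsTranslate Q₁ Q₂ ∧ ∀ θ : ℝ, s θ = 0 := fun h => by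
    refine ⟨h, fun θ => ?_⟩
    have := hs' θ
    rw [Pi.sub_apply, h.faceLength_eq, sub_self, Real.sign_zero] at this
    exact_mod_cast this
  have hper : Function.Periodic (faceLength Q₁ - faceLength Q₂) (2 * Real.pi) := fun θ => by
    simp [faceLength, nvec_add_two_pi]
  obtain ⟨A, hA, -⟩ := h₁.exists_isEdgePath
  obtain ⟨B, hB, -⟩ := h₂.exists_isEdgePath
  rcases hasFourAlternations_or_hasShortNonposArc hper (hA.sub hB).eventually_eq_zero with
    ⟨θ₁, θ₂, θ₃, θ₄, h₁₂, h₂₃, h₃₄, h₄₁, hθ₁, hθ₂, hθ₃, hθ₄⟩ | h | h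
  · exact Or.inr ⟨θ₁, θ₂, θ₃, θ₄, h₁₂, h₂₃, h₃₄, h₄₁,
      Or.inl ⟨hpos _ hθ₁, hneg _ hθ₂, hpos _ hθ₃, hneg _ hθ₄⟩⟩
  · exact Or.inl (hzero (eq_translate_of_hasShortNonposArc h₁ h₂ hno₂ h).symm)
  · rw [neg_sub] at h
    exact Or.inl (hzero (eq_translate_of_hasShortNonposArc h₂ h₁ hno₁ h))
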